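/- arXiv:1410.6511 — 5 statements merged into one kernel-verified Lean document; each statement's English description precedes it below -/
import Mathlib

section
/- Let k be a field and n ≥ 4; work in R = k[x₁,…,xₙ]. Let integers 1 ≤ a ≤ b ≤ c. Then (x₁) ∩ I_{n,a,b,c} = x₁·I_{n,a,b−1,c−1}, i.e., the intersection of the principal ideal (x₁) with P₁^a ∩ P₂^b ∩ P₃^c equals x₁·(P₁^a ∩ P₂^{b−1} ∩ P₃^{c−1}). -/
open MvPolynomial

/-- The ideal of `R = k[x₁,…,xₙ]` generated by all the variables except `x_t`. -/
noncomputable def Pt (k : Type*) [Field k] (n : ℕ) (t : Fin n) :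
    Ideal (MvPolynomial (Fin n) k) :=
  Ideal.span (X '' {i | i ≠ t})

/-- `I_{n,a,b,c} = P₁^a ∩ P₂^b ∩ P₃^c`, the defining ideal of the scheme of three general
(coordinate) fat points `{(P₁,a),(P₂,b),(P₃,c)}` in ℙ^{n-1}. -/
noncomputable def fatIdeal (k : Type*) [Field k] (n : ℕ) (hn : 4 ≤ n) (a b c : ℕ) :
    Ideal (MvPolynomial (Fin n) k) :=
  Pt k n ⟨0, by omega⟩ ^ a ⊓ Pt k n ⟨1, by omega⟩ ^ b ⊓ Pt k n ⟨2, by omega⟩ ^ c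

/-- The weight of an exponent vector that counts only the variables in `s`. -/
noncomputable abbrev weightOn {σ : Type*} (s : Set σ) : (σ →₀ ℕ) →+ ℕ :=
  Finsupp.weight (s.indicator 1)

theorem mem_span_X_image_pow_iff {σ R : Type*} [CommRing R] (s : Set σ) (d : ℕ)
    (f : MvPolynomial σ R) :
    f ∈ Ideal.span (X '' s : Set (MvPolynomial σ R)) ^ d ↔
      ∀ m ∈ f.support, d ≤ weightOn s m := by
  classical
  constructor
  · intro hf
    induction d generalizing f with
    | zero => simp
    | succ d ih =>
      rw [pow_succ] at hf
      induction hf using Submodule.mul_induction_on' with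
      | mem_mul_mem p hp q hq =>
        intro m hm
        obtain ⟨u, hu, v, hv, rfl⟩ := Finset.mem_add.mp (support_mul p q hm)
        obtain ⟨i, hi, hvi⟩ := mem_ideal_span_X_image.mp hq v hv
        have hle : 1 ≤ weightOn s v := by
          have h := Finsupp.le_weight_of_ne_zero' (s.indicator (1 : σ → ℕ)) hvi
          simpa [hi] using h
        rw [map_add]
        exact add_le_add (ih p hp u hu) hle
      | add p _ q _ hp hq =>
        intro m hm
        rcases Finset.mem_union.mp (support_add hm) with h | h
        · exact hp m h
        · exact hq m h
  · intro h
    rw [f.as_sum]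
    refine Ideal.sum_mem _ fun m hm => Ideal.pow_le_pow_right (h m hm) ?_
    rw [monomial_eq]
    refine Ideal.mul_mem_left _ _ ?_
    rw [weightOn, Finsupp.weight_apply, Finsupp.sum, Finsupp.prod, ← Finset.prod_pow_eq_pow_sum]
    refine Ideal.prod_mem_prod fun i _ => ?_
    by_cases hi : i ∈ s
    · simpa [hi] using Ideal.pow_mem_pow (Ideal.subset_span (Set.mem_image_of_mem X hi)) (m i)
    · simp [hi]

theorem X_mul_mem_span_X_image_pow_iff {σ R : Type*} [CommRing R] (s : Set σ) (d : ℕ) (i : σ)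
    (f : MvPolynomial σ R) :
    X i * f ∈ Ideal.span (X '' s : Set (MvPolynomial σ R)) ^ d ↔
      ∀ m ∈ f.support, d ≤ s.indicator 1 i + weightOn s m := by
  simp [mem_span_X_image_pow_iff, support_X_mul, weightOn, Finsupp.weight_single]

theorem X_mul_mem_Pt_pow_self_iff {k : Type*} [Field k] {n : ℕ} (t : Fin n) (d : ℕ)
    (f : MvPolynomial (Fin n) k) : X t * f ∈ Pt k n t ^ d ↔ f ∈ Pt k n t ^ d := by
  rw [Pt, X_mul_mem_span_X_image_pow_iff, mem_span_X_image_pow_iff]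
  simp

theorem X_mul_mem_Pt_pow_iff_of_ne {k : Type*} [Field k] {n : ℕ} {i t : Fin n} (h : i ≠ t)
    (d : ℕ) (f : MvPolynomial (Fin n) k) : X i * f ∈ Pt k n t ^ d ↔ f ∈ Pt k n t ^ (d - 1) := by
  rw [Pt, X_mul_mem_span_X_image_pow_iff, mem_span_X_image_pow_iff]
  simp [h, add_comm 1]

/-- `(x₁) ∩ I_{n,a,b,c} = x₁ · I_{n,a,b-1,c-1}` for `1 ≤ a ≤ b ≤ c`. -/
theorem principal_inter_fatIdeal (k : Type*) [Field k] (n : ℕ) (hn : 4 ≤ n)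
    (a b c : ℕ) (ha : 1 ≤ a) (hab : a ≤ b) (hbc : b ≤ c) :
    Ideal.span {(X (⟨0, by omega⟩ : Fin n) : MvPolynomial (Fin n) k)} ⊓ fatIdeal k n hn a b c
      = Ideal.span {(X (⟨0, by omega⟩ : Fin n) : MvPolynomial (Fin n) k)}
        * fatIdeal k n hn a (b - 1) (c - 1) := by
  have key (g : MvPolynomial (Fin n) k) : X ⟨0, by omega⟩ * g ∈ fatIdeal k n hn a b c ↔
      g ∈ fatIdeal k n hn a (b - 1) (c - 1) := by
    simp only [fatIdeal, Ideal.mem_inf]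
    rw [X_mul_mem_Pt_pow_self_iff, X_mul_mem_Pt_pow_iff_of_ne (by simp),
      X_mul_mem_Pt_pow_iff_of_ne (by simp)]
  ext f
  rw [Ideal.mem_inf, Ideal.mem_span_singleton, Ideal.mem_span_singleton_mul]
  constructor
  · rintro ⟨⟨g, rfl⟩, hg⟩
    exact ⟨g, (key g).mp hg, rfl⟩
  · rintro ⟨g, hg, rfl⟩
    exact ⟨dvd_mul_right _ _, (key g).mpr hg⟩
end

section
/- Let k be a field and n ≥ 4; work in R = k[x₁,…,xₙ]. Let integers 1 ≤ a ≤ b ≤ c. Set J = x₁·I_{n,a,b−1,c−1} and K = (x₃,…,xₙ)^b ∩ (x₂,x₄,…,xₙ)^c. Then I_{n,a,b,c} = J + K. -/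
open MvPolynomial

/-- `K = (x₃,…,xₙ)^b ∩ (x₂,x₄,…,xₙ)^c`, where `(x₃,…,xₙ)` is generated by all variables
except `x₁, x₂` and `(x₂,x₄,…,xₙ)` by all variables except `x₁, x₃`. -/
noncomputable def Kideal (k : Type*) [Field k] (n : ℕ) (hn : 4 ≤ n) (b c : ℕ) :
    Ideal (MvPolynomial (Fin n) k) :=
  Ideal.span (X '' {i : Fin n | 2 ≤ (i : ℕ)}) ^ b
    ⊓ Ideal.span (X '' {i : Fin n | i ≠ ⟨0, by omega⟩ ∧ i ≠ ⟨2, by omega⟩}) ^ c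

theorem MvPolynomial.monomial_mem_span_X_pow {σ k : Type*} [CommSemiring k] (S : Finset σ)
    (d : ℕ) (m : σ →₀ ℕ) (r : k) (h : d ≤ ∑ i ∈ S, m i) :
    monomial m r ∈ Ideal.span (X '' (S : Set σ) : Set (MvPolynomial σ k)) ^ d := by
  classical
  induction d generalizing m with
  | zero => simp
  | succ d ih =>
    obtain ⟨i, hi, hmi⟩ : ∃ i ∈ S, m i ≠ 0 := by
      by_contra! h0
      rw [Finset.sum_eq_zero h0] at h
      omega
    have hle : Finsupp.single i 1 ≤ m := by
      simpa [Finsupp.single_le_iff, Nat.one_le_iff_ne_zero] using hmi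
    obtain ⟨m', rfl⟩ := exists_add_of_le hle
    have hm' : d ≤ ∑ j ∈ S, m' j := by
      simp [Finset.sum_add_distrib, Finsupp.single_apply, hi] at h
      omega
    rw [pow_succ', monomial_single_add, pow_one]
    exact Ideal.mul_mem_mul (Ideal.subset_span ⟨i, hi, rfl⟩) (ih m' hm')

theorem MvPolynomial.le_sum_of_mem_span_X_pow {σ k : Type*} [CommSemiring k] (S : Finset σ)
    (d : ℕ) (p : MvPolynomial σ k)
    (hp : p ∈ Ideal.span (X '' (S : Set σ) : Set (MvPolynomial σ k)) ^ d)
    (m : σ →₀ ℕ) (hm : m ∈ p.support) : d ≤ ∑ i ∈ S, m i := by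
  classical
  induction d generalizing p m with
  | zero => simp
  | succ d ih =>
    rw [pow_succ'] at hp
    induction hp using Submodule.mul_induction_on' generalizing m with
    | mem_mul_mem u hu v hv =>
      obtain ⟨y, hy, z, hz, rfl⟩ := Finset.mem_add.1 (support_mul u v hm)
      obtain ⟨i, hi, hyi⟩ := mem_ideal_span_X_image.1 hu y hy
      have hpos : y i ≤ ∑ j ∈ S, y j :=
        Finset.single_le_sum (f := fun j => y j) (fun _ _ => Nat.zero_le _) hi
      have hz' := ih v hv z hz
      simp only [Finsupp.add_apply, Finset.sum_add_distrib]
      omega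
    | add u _ v _ hu hv =>
      rcases Finset.mem_union.1 (support_add hm) with h | h
      exacts [hu m h, hv m h]

theorem MvPolynomial.mem_span_X_pow_iff {σ k : Type*} [CommSemiring k] (S : Finset σ)
    (d : ℕ) (p : MvPolynomial σ k) :
    p ∈ Ideal.span (X '' (S : Set σ) : Set (MvPolynomial σ k)) ^ d ↔
      ∀ m ∈ p.support, d ≤ ∑ i ∈ S, m i := by
  refine ⟨le_sum_of_mem_span_X_pow S d p, fun h => ?_⟩
  rw [p.as_sum]
  exact Ideal.sum_mem _ fun m hm => monomial_mem_span_X_pow S d m _ (h m hm)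

theorem mem_Pt_pow_iff {k : Type*} [Field k] {n : ℕ} (t : Fin n) (d : ℕ)
    (p : MvPolynomial (Fin n) k) :
    p ∈ Pt k n t ^ d ↔ ∀ m ∈ p.support, d ≤ ∑ i with i ≠ t, m i := by
  rw [← mem_span_X_pow_iff, Finset.coe_filter_univ, Pt]

theorem X_mul_mem_Pt_pow {k : Type*} [Field k] {n : ℕ} {s t : Fin n} (hst : s ≠ t) {d : ℕ}
    (hd : 1 ≤ d) {p : MvPolynomial (Fin n) k} (hp : p ∈ Pt k n t ^ (d - 1)) :
    X s * p ∈ Pt k n t ^ d := by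
  rw [← Nat.sub_add_cancel hd, pow_succ']
  exact Ideal.mul_mem_mul (Ideal.subset_span ⟨s, hst, rfl⟩) hp

/-- With `J = x₁ · I_{n,a,b-1,c-1}` and
`K = (x₃,…,xₙ)^b ∩ (x₂,x₄,…,xₙ)^c`, one has `I_{n,a,b,c} = J + K` for `1 ≤ a ≤ b ≤ c`. -/
theorem fatIdeal_eq_add (k : Type*) [Field k] (n : ℕ) (hn : 4 ≤ n)
    (a b c : ℕ) (ha : 1 ≤ a) (hab : a ≤ b) (hbc : b ≤ c) :
    fatIdeal k n hn a b c
      = Ideal.span {(X (⟨0, by omega⟩ : Fin n) : MvPolynomial (Fin n) k)}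
          * fatIdeal k n hn a (b - 1) (c - 1)
        + Kideal k n hn b c := by
  rw [Submodule.add_eq_sup]
  apply le_antisymm
  · rintro p ⟨⟨h1, h2⟩, h3⟩
    rw [SetLike.mem_coe, mem_Pt_pow_iff] at h1 h2 h3
    rw [p.as_sum]
    refine Ideal.sum_mem _ fun m hm => ?_
    specialize h1 m hm
    specialize h2 m hm
    specialize h3 m hm
    by_cases h0 : m ⟨0, by omega⟩ = 0
    · refine Ideal.mem_sup_right ⟨?_, ?_⟩
      · have := monomial_mem_span_X_pow ({i : Fin n | 2 ≤ (i : ℕ)} : Finset (Fin n)) b m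
          (coeff m p) (h2.trans_eq (Finset.sum_subset_zero_on_sdiff (fun i hi => ?_)
            (fun i hi => ?_) (fun _ _ => rfl)).symm)
        · rwa [Finset.coe_filter_univ] at this
        · simp [Fin.ext_iff] at hi ⊢
          omega
        · have : i = ⟨0, by omega⟩ := by
            simp [Fin.ext_iff] at hi ⊢
            omega
          rw [this, h0]
      · have := monomial_mem_span_X_pow
          ({i : Fin n | i ≠ ⟨0, by omega⟩ ∧ i ≠ ⟨2, by omega⟩} : Finset (Fin n)) c m
          (coeff m p) (h3.trans_eq (Finset.sum_subset_zero_on_sdiff (fun i hi => ?_)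
            (fun i hi => ?_) (fun _ _ => rfl)).symm)
        · rwa [Finset.coe_filter_univ] at this
        · simp [Fin.ext_iff] at hi ⊢
          omega
        · have : i = ⟨0, by omega⟩ := by
            simp [Fin.ext_iff] at hi ⊢
            omega
          rw [this, h0]
    · apply Ideal.mem_sup_left
      have hle : Finsupp.single ⟨0, by omega⟩ 1 ≤ m := by
        simpa [Finsupp.single_le_iff, Nat.one_le_iff_ne_zero] using h0
      obtain ⟨m', hm'⟩ := exists_add_of_le hle
      rw [hm', monomial_single_add, pow_one, ← hm']
      rw [hm'] at h1 h2 h3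
      refine Ideal.mul_mem_mul (Ideal.mem_span_singleton_self _) ⟨⟨?_, ?_⟩, ?_⟩
      all_goals
        rw [SetLike.mem_coe, Pt, ← Finset.coe_filter_univ]
        apply monomial_mem_span_X_pow
        simp [Finset.sum_add_distrib, Finsupp.single_apply] at h1 h2 h3 ⊢
        omega
  · refine sup_le (Ideal.span_singleton_mul_le_iff.2 ?_) ?_
    · rintro q ⟨⟨h1, h2⟩, h3⟩
      exact ⟨⟨Ideal.mul_mem_left _ _ h1, X_mul_mem_Pt_pow (by simp) (by omega) h2⟩,
        X_mul_mem_Pt_pow (by simp) (by omega) h3⟩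
    · have hP : ∀ t : Fin n, (t : ℕ) < 2 →
          Ideal.span (X '' {i : Fin n | 2 ≤ (i : ℕ)}) ≤ Pt k n t := fun t ht =>
        Ideal.span_mono (Set.image_mono fun i (hi : 2 ≤ (i : ℕ)) => by
          rintro rfl
          omega)
      refine le_inf (le_inf (inf_le_left.trans ?_) (inf_le_left.trans ?_)) (inf_le_right.trans ?_)
      · exact (Ideal.pow_right_mono (hP _ (by simp)) b).trans (Ideal.pow_le_pow_right hab)
      · exact Ideal.pow_right_mono (hP _ (by simp)) b
      · exact Ideal.pow_right_mono (Ideal.span_mono (Set.image_mono fun i hi => hi.2)) c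
end

section
/- Let k be a field and n ≥ 4; work in R = k[x₁,…,xₙ] with maximal homogeneous ideal m = (x₁,…,xₙ). Let integers 1 ≤ a ≤ b ≤ c with a < c. Then K = (x₃,…,xₙ)^b ∩ (x₂,x₄,…,xₙ)^c satisfies K ⊆ m·I_{n,a,b−1,c−1}. -/
open MvPolynomial

/-- The maximal homogeneous ideal `m = (x₁,…,xₙ)` of `R = k[x₁,…,xₙ]`. -/
noncomputable def maxIdeal (k : Type*) [Field k] (n : ℕ) :
    Ideal (MvPolynomial (Fin n) k) :=
  Ideal.span (Set.range X)

section PowersOfVariableIdeals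

variable {σ R : Type*} [CommSemiring R]

/-- A monomial whose degree in the variables from `S` is at least `d` lies in the `d`-th power
of the ideal generated by these variables. -/
theorem monomial_mem_span_X_image_pow [Fintype σ] (S : Finset σ) {d : ℕ} {e : σ →₀ ℕ}
    (h : d ≤ ∑ i ∈ S, e i) (r : R) :
    monomial e r ∈ Ideal.span ((X : σ → MvPolynomial σ R) '' (S : Set σ)) ^ d := by
  classical
  refine Ideal.pow_le_pow_right h ?_
  rw [monomial_eq, Finsupp.prod_fintype _ _ (fun i => pow_zero _),
    ← Finset.prod_mul_prod_compl S]
  refine Ideal.mul_mem_left _ _ (Ideal.mul_mem_right _ _ ?_)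
  rw [← Finset.prod_pow_eq_pow_sum]
  exact Ideal.prod_mem_prod fun i hi =>
    Ideal.pow_mem_pow (Ideal.subset_span (Set.mem_image_of_mem X hi)) _

/-- The `d`-th power of the ideal generated by the variables from `S` consists of polynomials
all of whose monomials have degree at least `d` in these variables. -/
theorem le_sum_of_mem_span_X_image_pow (S : Finset σ) {d : ℕ} {p : MvPolynomial σ R}
    (hp : p ∈ Ideal.span ((X : σ → MvPolynomial σ R) '' (S : Set σ)) ^ d)
    {e : σ →₀ ℕ} (he : e ∈ p.support) : d ≤ ∑ i ∈ S, e i := by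
  classical
  induction d generalizing p e with
  | zero => exact Nat.zero_le _
  | succ d ih =>
    rw [pow_succ] at hp
    induction hp using Submodule.mul_induction_on' generalizing e with
    | mem_mul_mem f hf g hg =>
      obtain ⟨u, hu, v, hv, rfl⟩ := Finset.mem_add.1 (support_mul f g he)
      obtain ⟨i, hi, hvi⟩ := mem_ideal_span_X_image.1 hg v hv
      have h1 := ih hf hu
      have h2 : v i ≤ ∑ j ∈ S, v j :=
        Finset.single_le_sum (f := fun j => v j) (fun _ _ => Nat.zero_le _) hi
      simp only [Finsupp.add_apply, Finset.sum_add_distrib]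
      omega
    | add f _ g _ hf hg =>
      rcases Finset.mem_union.1 (support_add he) with h | h
      exacts [hf h, hg h]

end PowersOfVariableIdeals

/-- For `1 ≤ a ≤ b ≤ c` with `a < c`, the ideal
`K = (x₃,…,xₙ)^b ∩ (x₂,x₄,…,xₙ)^c` satisfies `K ⊆ m · I_{n,a,b-1,c-1}`. -/
theorem Kideal_subset_max_mul_fatIdeal (k : Type*) [Field k] (n : ℕ) (hn : 4 ≤ n)
    (a b c : ℕ) (ha : 1 ≤ a) (hab : a ≤ b) (hbc : b ≤ c) (hac : a < c) :
    Kideal k n hn b c ≤ maxIdeal k n * fatIdeal k n hn a (b - 1) (c - 1) := by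
  classical
  rintro p ⟨hpb, hpc⟩
  set A : Finset (Fin n) := {i | 2 ≤ (i : ℕ)} with hA
  set B : Finset (Fin n) := {i | i ≠ ⟨0, by omega⟩ ∧ i ≠ ⟨2, by omega⟩} with hB
  have hb := fun e he => le_sum_of_mem_span_X_image_pow A (d := b) (p := p) (e := e)
    (by simpa [hA] using hpb) he
  have hc := fun e he => le_sum_of_mem_span_X_image_pow B (d := c) (p := p) (e := e)
    (by simpa [hB] using hpc) he
  rw [p.as_sum]
  refine Ideal.sum_mem _ fun e he => ?_
  specialize hb e he
  specialize hc e he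
  obtain ⟨i, hiB, hi⟩ : ∃ i ∈ B, e i ≠ 0 := by
    by_contra! h
    rw [Finset.sum_eq_zero h] at hc
    omega
  obtain ⟨f, rfl⟩ : ∃ f, e = Finsupp.single i 1 + f :=
    ⟨e - Finsupp.single i 1, (add_tsub_cancel_of_le (by simpa [Nat.one_le_iff_ne_zero])).symm⟩
  have hsingle : ∀ S : Finset (Fin n), ∑ j ∈ S, (Finsupp.single i 1 : Fin n →₀ ℕ) j ≤ 1 := by
    intro S
    simp only [Finsupp.single_apply, Finset.sum_ite_eq]
    split_ifs <;> omega
  simp only [Finsupp.add_apply, Finset.sum_add_distrib] at hb hc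
  have hbf : b - 1 ≤ ∑ j ∈ A, f j := by have := hsingle A; omega
  have hcf : c - 1 ≤ ∑ j ∈ B, f j := by have := hsingle B; omega
  have hmem : ∀ (t : Fin n) (d : ℕ) (S : Finset (Fin n)), t ∉ S → d ≤ ∑ j ∈ S, f j →
      monomial f (coeff (Finsupp.single i 1 + f) p) ∈ Pt k n t ^ d := by
    intro t d S htS hd
    have hS : S ⊆ Finset.univ.filter (· ≠ t) := fun j hj => by
      simpa using fun h : j = t => htS (h ▸ hj)
    simpa [Pt] using monomial_mem_span_X_image_pow (Finset.univ.filter (· ≠ t))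
      (hd.trans (Finset.sum_le_sum_of_subset hS)) (coeff (Finsupp.single i 1 + f) p)
  rw [← one_mul (coeff _ p), ← monomial_mul]
  refine Ideal.mul_mem_mul (Ideal.subset_span ⟨i, rfl⟩) ⟨⟨?_, ?_⟩, ?_⟩
  · exact hmem _ _ B (by simp [hB]) (by omega)
  · exact hmem _ _ A (by simp [hA]) hbf
  · exact hmem _ _ B (by simp [hB]) hcf
end

section
/- Let k be a field and n ≥ 4; work in R = k[x₁,…,xₙ] with maximal homogeneous ideal m = (x₁,…,xₙ). Let integers 1 ≤ a ≤ b ≤ c with a < c. Set I = I_{n,a,b,c}, J = x₁·I_{n,a,b−1,c−1} and K = (x₃,…,xₙ)^b ∩ (x₂,x₄,…,xₙ)^c. Then the set of minimal monomial generators of I equals the union of the set of minimal monomial generators of J and the set of minimal monomial generators of K; that is, for every monomial u of R, (u ∈ I and u ∉ m·I) if and only if (u ∈ J and u ∉ m·J) or (u ∈ K and u ∉ m·K). -/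
open MvPolynomial

/-- `u` is a monomial of `R = k[x₁,…,xₙ]`. -/
def IsMonomial {k : Type*} [Field k] {n : ℕ} (u : MvPolynomial (Fin n) k) : Prop :=
  ∃ d : Fin n →₀ ℕ, u = monomial d 1

/-- `u` is a minimal monomial generator of the monomial ideal `L`:
`u ∈ L` and `u ∉ m·L`. -/
def IsMinGen {k : Type*} [Field k] {n : ℕ} (L : Ideal (MvPolynomial (Fin n) k))
    (u : MvPolynomial (Fin n) k) : Prop :=
  u ∈ L ∧ u ∉ maxIdeal k n * L

/-- The degree of the exponent vector `d` in the variables indexed by `S`. -/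
noncomputable def partialDegree {n : ℕ} (S : Set (Fin n)) (d : Fin n →₀ ℕ) : ℕ :=
  ∑ i, S.indicator d i

theorem partialDegree_add {n : ℕ} (S : Set (Fin n)) (d e : Fin n →₀ ℕ) :
    partialDegree S (d + e) = partialDegree S d + partialDegree S e := by
  simp [partialDegree, Set.indicator_add', Finset.sum_add_distrib]

theorem partialDegree_single_of_mem {n : ℕ} {S : Set (Fin n)} {i : Fin n} (hi : i ∈ S) :
    partialDegree S (Finsupp.single i 1) = 1 := by
  unfold partialDegree
  rw [Finset.sum_eq_single i]
  · simp [hi]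
  · intro j _ hj
    simp [hj]
  · simp

theorem partialDegree_single_of_notMem {n : ℕ} {S : Set (Fin n)} {i : Fin n} (hi : i ∉ S) :
    partialDegree S (Finsupp.single i 1) = 0 := by
  refine Finset.sum_eq_zero fun j _ ↦ ?_
  by_cases hj : j ∈ S
  · have : i ≠ j := fun h ↦ hi (h ▸ hj)
    simp [hj, this]
  · simp [hj]

theorem exists_mem_ne_zero_of_partialDegree_ne_zero {n : ℕ} {S : Set (Fin n)} {d : Fin n →₀ ℕ}
    (h : partialDegree S d ≠ 0) : ∃ i ∈ S, d i ≠ 0 := by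
  obtain ⟨i, -, hi⟩ := Finset.exists_ne_zero_of_sum_ne_zero h
  exact ⟨i, Set.mem_of_indicator_ne_zero hi, fun h0 ↦ hi (by simp [h0])⟩

theorem partialDegree_ne_zero {n : ℕ} {S : Set (Fin n)} {d : Fin n →₀ ℕ} {i : Fin n}
    (hi : i ∈ S) (hd : d i ≠ 0) : partialDegree S d ≠ 0 := by
  intro h
  have := Finset.sum_eq_zero_iff.mp h i (Finset.mem_univ i)
  simp [hi, hd] at this

theorem partialDegree_insert {n : ℕ} {S : Set (Fin n)} {i : Fin n} (hi : i ∉ S)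
    (d : Fin n →₀ ℕ) : partialDegree (insert i S) d = d i + partialDegree S d := by
  classical
  unfold partialDegree
  rw [← Finset.add_sum_erase _ _ (Finset.mem_univ i),
    ← Finset.add_sum_erase _ (S.indicator d) (Finset.mem_univ i)]
  simp only [Set.indicator_of_notMem hi, Set.indicator_of_mem (Set.mem_insert i S), zero_add]
  congr 1
  refine Finset.sum_congr rfl fun j hj ↦ ?_
  simp [Set.indicator_apply, Finset.ne_of_mem_erase hj]

theorem exists_eq_add_single {σ : Type*} {d : σ →₀ ℕ} {i : σ} (h : d i ≠ 0) :
    ∃ e, d = e + Finsupp.single i 1 :=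
  ⟨_, (tsub_add_cancel_of_le (Finsupp.single_le_iff.mpr (Nat.pos_of_ne_zero h))).symm⟩

/-- `L` consists of the polynomials all of whose exponent vectors satisfy `M`. -/
def IsMonomialIdealOf {k : Type*} [Field k] {n : ℕ} (L : Ideal (MvPolynomial (Fin n) k))
    (M : (Fin n →₀ ℕ) → Prop) : Prop :=
  ∀ p, p ∈ L ↔ ∀ d ∈ p.support, M d

section

variable {k : Type*} [Field k] {n : ℕ}

theorem IsMonomialIdealOf.monomial_mem_iff {L : Ideal (MvPolynomial (Fin n) k)}
    {M : (Fin n →₀ ℕ) → Prop} (h : IsMonomialIdealOf L M) (d : Fin n →₀ ℕ) :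
    monomial d (1 : k) ∈ L ↔ M d := by
  classical
  rw [h, support_monomial]
  simp

theorem isMonomialIdealOf_of_le {L : Ideal (MvPolynomial (Fin n) k)}
    {M : (Fin n →₀ ℕ) → Prop} (h₁ : ∀ p ∈ L, ∀ d ∈ p.support, M d)
    (h₂ : ∀ d, M d → monomial d (1 : k) ∈ L) : IsMonomialIdealOf L M := by
  refine fun p ↦ ⟨h₁ p, fun hp ↦ ?_⟩
  rw [p.as_sum]
  refine sum_mem fun d hd ↦ ?_
  have := L.mul_mem_left (C (p.coeff d)) (h₂ d (hp d hd))
  rwa [C_mul_monomial, mul_one] at this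

theorem IsMonomialIdealOf.inf {L L' : Ideal (MvPolynomial (Fin n) k)}
    {M M' : (Fin n →₀ ℕ) → Prop} (h : IsMonomialIdealOf L M) (h' : IsMonomialIdealOf L' M') :
    IsMonomialIdealOf (L ⊓ L') fun d ↦ M d ∧ M' d := by
  intro p
  rw [Ideal.mem_inf, h, h']
  exact ⟨fun H d hd ↦ ⟨H.1 d hd, H.2 d hd⟩, fun H ↦ ⟨fun d hd ↦ (H d hd).1, fun d hd ↦ (H d hd).2⟩⟩

/-- The product of two monomial ideals is the monomial ideal of sums of exponents. -/
theorem IsMonomialIdealOf.mul {L L' : Ideal (MvPolynomial (Fin n) k)}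
    {M M' : (Fin n →₀ ℕ) → Prop} (h : IsMonomialIdealOf L M) (h' : IsMonomialIdealOf L' M') :
    IsMonomialIdealOf (L * L') fun d ↦ ∃ e e', M e ∧ M' e' ∧ d = e + e' := by
  classical
  refine isMonomialIdealOf_of_le (fun p hp ↦ ?_) ?_
  · induction hp using Submodule.mul_induction_on' with
    | mem_mul_mem f hf g hg =>
      intro d hd
      obtain ⟨e, he, e', he', rfl⟩ := Finset.mem_add.mp (support_mul f g hd)
      exact ⟨e, e', (h f).mp hf e he, (h' g).mp hg e' he', rfl⟩
    | add f _ g _ hf hg =>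
      intro d hd
      exact (Finset.mem_union.mp (support_add hd)).elim (hf d) (hg d)
  · rintro _ ⟨e, e', he, he', rfl⟩
    have := Ideal.mul_mem_mul ((h.monomial_mem_iff e).mpr he) ((h'.monomial_mem_iff e').mpr he')
    rwa [monomial_mul, mul_one] at this

theorem isMonomialIdealOf_span_X (S : Set (Fin n)) :
    IsMonomialIdealOf (Ideal.span (X '' S : Set (MvPolynomial (Fin n) k)))
      fun d ↦ ∃ i ∈ S, d i ≠ 0 :=
  fun _ ↦ mem_ideal_span_X_image

theorem isMonomialIdealOf_span_X_pow (S : Set (Fin n)) (a : ℕ) :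
    IsMonomialIdealOf (Ideal.span (X '' S : Set (MvPolynomial (Fin n) k)) ^ a)
      fun d ↦ a ≤ partialDegree S d := by
  induction a with
  | zero => intro p; simp
  | succ a ih =>
    intro p
    rw [pow_succ, (ih.mul (isMonomialIdealOf_span_X S)) p]
    refine forall₂_congr fun d _ ↦ ⟨?_, fun hd ↦ ?_⟩
    · rintro ⟨e, e', he, ⟨i, hi, hi'⟩, rfl⟩
      have := partialDegree_ne_zero hi hi'
      rw [partialDegree_add]
      omega
    · obtain ⟨i, hi, hi'⟩ := exists_mem_ne_zero_of_partialDegree_ne_zero (a.succ_pos.trans_le hd).ne'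
      obtain ⟨e, rfl⟩ := exists_eq_add_single hi'
      rw [partialDegree_add, partialDegree_single_of_mem hi] at hd
      exact ⟨e, _, by omega, ⟨i, hi, by simp⟩, rfl⟩

/-- A monomial generator of a monomial ideal is minimal iff dividing it by any variable leaves
the ideal. -/
theorem IsMonomialIdealOf.isMinGen_iff {L : Ideal (MvPolynomial (Fin n) k)}
    {M : (Fin n →₀ ℕ) → Prop} (h : IsMonomialIdealOf L M) (d : Fin n →₀ ℕ) :
    IsMinGen L (monomial d (1 : k)) ↔
      M d ∧ ∀ e i, d = e + Finsupp.single i 1 → ¬ M e := by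
  have hm := (isMonomialIdealOf_span_X (k := k) (Set.univ : Set (Fin n))).mul h
  rw [Set.image_univ] at hm
  unfold IsMinGen maxIdeal
  rw [h.monomial_mem_iff, hm.monomial_mem_iff]
  refine and_congr_right fun _ ↦ ⟨?_, ?_⟩
  · rintro H e i rfl he
    exact H ⟨Finsupp.single i 1, e, ⟨i, trivial, by simp⟩, he, add_comm _ _⟩
  · rintro H ⟨f, e, ⟨i, -, hi⟩, he, rfl⟩
    obtain ⟨f, rfl⟩ := exists_eq_add_single hi
    refine H (f + e) i (add_right_comm _ _ _) ?_
    rw [← h.monomial_mem_iff] at he ⊢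
    have := L.mul_mem_left (monomial f 1) he
    rwa [monomial_mul, mul_one] at this

end

/-- For `1 ≤ a ≤ b ≤ c` with `a < c`, set `I = I_{n,a,b,c}`,
`J = x₁ · I_{n,a,b-1,c-1}` and `K = (x₃,…,xₙ)^b ∩ (x₂,x₄,…,xₙ)^c`. Then for every
monomial `u`, `u` is a minimal monomial generator of `I` iff it is a minimal
monomial generator of `J` or of `K`. -/
theorem minGen_fatIdeal_iff (k : Type*) [Field k] (n : ℕ) (hn : 4 ≤ n)
    (a b c : ℕ) (ha : 1 ≤ a) (hab : a ≤ b) (hbc : b ≤ c) (hac : a < c) :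
    ∀ u : MvPolynomial (Fin n) k, IsMonomial u →
      (IsMinGen (fatIdeal k n hn a b c) u ↔
        IsMinGen (Ideal.span {(X (⟨0, by omega⟩ : Fin n) : MvPolynomial (Fin n) k)}
            * fatIdeal k n hn a (b - 1) (c - 1)) u
        ∨ IsMinGen (Kideal k n hn b c) u) := by
  rintro _ ⟨d, rfl⟩
  obtain ⟨n, rfl⟩ : ∃ m, n = m + 3 := ⟨n - 3, by omega⟩
  unfold fatIdeal Kideal Pt
  set x : Fin (n + 3) := ⟨0, by omega⟩
  set y : Fin (n + 3) := ⟨1, by omega⟩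
  set z : Fin (n + 3) := ⟨2, by omega⟩
  have hxy : x ≠ y := by simp [x, y]
  have hxz : x ≠ z := by simp [x, z]
  have hyz : y ≠ z := by simp [y, z]
  have hS : {i : Fin (n + 3) | 2 ≤ (i : ℕ)} = {i | i ≠ x ∧ i ≠ y} := by
    ext i
    simp only [Set.mem_ofPred_eq, ne_eq, Fin.ext_iff, x, y]
    omega
  rw [hS]
  clear_value x y z
  clear hS
  set W : Set (Fin (n + 3)) := {i | i ≠ x ∧ i ≠ y ∧ i ≠ z}
  have hxW : x ∉ W := by simp [W]
  have hyW : y ∉ W := by simp [W]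
  have hzW : z ∉ W := by simp [W]
  obtain ⟨h₁, h₂, h₃, h₁₂, h₁₃⟩ : {i : Fin (n + 3) | i ≠ x} = insert y (insert z W) ∧
      {i : Fin (n + 3) | i ≠ y} = insert x (insert z W) ∧
      {i : Fin (n + 3) | i ≠ z} = insert x (insert y W) ∧
      {i : Fin (n + 3) | i ≠ x ∧ i ≠ y} = insert z W ∧
      {i : Fin (n + 3) | i ≠ x ∧ i ≠ z} = insert y W := by
    refine ⟨?_, ?_, ?_, ?_, ?_⟩ <;> ext i <;>
      simp only [W, Set.mem_ofPred_eq, Set.mem_insert_iff] <;> grind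
  have hP (S : Set (Fin (n + 3))) (e : ℕ) := isMonomialIdealOf_span_X_pow (k := k) S e
  have hI (a b c : ℕ) := ((hP {i | i ≠ x} a).inf (hP {i | i ≠ y} b)).inf (hP {i | i ≠ z} c)
  have hX := isMonomialIdealOf_span_X (k := k) {x}
  rw [Set.image_singleton] at hX
  have hJ := hX.mul (hI a (b - 1) (c - 1))
  have hK := (hP {i | i ≠ x ∧ i ≠ y} b).inf (hP {i | i ≠ x ∧ i ≠ z} c)
  have d₁ (e) : partialDegree (insert y (insert z W)) e = e y + (e z + partialDegree W e) := by
    rw [partialDegree_insert (by simp [hyz, hyW]), partialDegree_insert hzW]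
  have d₂ (e) : partialDegree (insert x (insert z W)) e = e x + (e z + partialDegree W e) := by
    rw [partialDegree_insert (by simp [hxz, hxW]), partialDegree_insert hzW]
  have d₃ (e) : partialDegree (insert x (insert y W)) e = e x + (e y + partialDegree W e) := by
    rw [partialDegree_insert (by simp [hxy, hxW]), partialDegree_insert hyW]
  rw [(hI a b c).isMinGen_iff, hJ.isMinGen_iff, hK.isMinGen_iff]
  have hJ_iff (e : Fin (n + 3) →₀ ℕ) :
      (∃ f g : Fin (n + 3) →₀ ℕ, (∃ i ∈ ({x} : Set (Fin (n + 3))), f i ≠ 0) ∧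
        ((a ≤ partialDegree {i | i ≠ x} g ∧ b - 1 ≤ partialDegree {i | i ≠ y} g) ∧
          c - 1 ≤ partialDegree {i | i ≠ z} g) ∧ e = f + g) ↔
      e x ≠ 0 ∧ a ≤ e y + (e z + partialDegree W e) ∧ b ≤ e x + (e z + partialDegree W e) ∧
        c ≤ e x + (e y + partialDegree W e) := by
    simp only [h₁, h₂, h₃, d₁, d₂, d₃]
    constructor
    · rintro ⟨f, g, ⟨_, rfl, hf⟩, hg, rfl⟩
      simp only [Finsupp.add_apply, partialDegree_add]
      omega
    · rintro ⟨hx, he⟩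
      obtain ⟨g, rfl⟩ := exists_eq_add_single hx
      simp only [Finsupp.add_apply, partialDegree_add, Finsupp.single_eq_same,
        Finsupp.single_eq_of_ne hxy.symm, Finsupp.single_eq_of_ne hxz.symm,
        partialDegree_single_of_notMem hxW] at he
      exact ⟨_, g, ⟨x, rfl, by simp⟩, by omega, add_comm _ _⟩
  simp only [hJ_iff]
  simp only [h₁, h₂, h₃, h₁₂, h₁₃, d₁, d₂, d₃, partialDegree_insert hyW,
    partialDegree_insert hzW]
  constructor
  · rintro ⟨hd, hmin⟩
    by_cases hx : d x = 0
    · refine .inr ⟨by omega, fun e i h he ↦ hmin e i h (by omega)⟩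
    · refine .inl ⟨by omega, fun e i h he ↦ hmin e i h (by omega)⟩
  · rintro (⟨hd, hmin⟩ | ⟨hd, hmin⟩)
    · refine ⟨by omega, fun e i h he ↦ ?_⟩
      by_cases hex : e x = 0
      · have hix : i = x := by
          by_contra hi
          have := DFunLike.congr_fun h x
          simp [hi, hex] at this
          omega
        subst i
        -- A variable of `{y} ∪ W` dividing `e` can be divided out instead.
        obtain ⟨j, hj, hj0⟩ := exists_mem_ne_zero_of_partialDegree_ne_zero
          (S := insert y W) (d := e) (by rw [partialDegree_insert hyW]; omega)
        obtain ⟨f, rfl⟩ := exists_eq_add_single hj0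
        refine hmin (f + Finsupp.single x 1) j (by rw [h, add_right_comm]) ?_
        rcases hj with rfl | hj
        · simp [partialDegree_add, partialDegree_single_of_notMem, *] at he hd ⊢
          omega
        · have hjx : j ≠ x := fun h ↦ hxW (h ▸ hj)
          have hjy : j ≠ y := fun h ↦ hyW (h ▸ hj)
          have hjz : j ≠ z := fun h ↦ hzW (h ▸ hj)
          simp [partialDegree_add, partialDegree_single_of_notMem hxW,
            partialDegree_single_of_mem hj, hxy, hxz, hjx, hjy, hjz] at he hd hex ⊢
          omega
      · exact hmin e i h (by omega)
    · have hx : d x = 0 := by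
        by_contra hx
        obtain ⟨e, rfl⟩ := exists_eq_add_single hx
        refine hmin e x rfl ?_
        simpa [partialDegree_add, partialDegree_single_of_notMem hxW, hxy, hxz] using hd
      refine ⟨by omega, fun e i h he ↦ hmin e i h ?_⟩
      have : e x = 0 := by
        have := DFunLike.congr_fun h x
        simp at this
        omega
      omega
end

section
/- Let k be a field and n ≥ 4; work in R = k[x₁,…,xₙ]. Let integers 1 ≤ a ≤ b ≤ c. Set J = x₁·I_{n,a,b−1,c−1} and K = (x₃,…,xₙ)^b ∩ (x₂,x₄,…,xₙ)^c. Then J ∩ K = x₁·K. -/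
open MvPolynomial

/-- Dividing by a variable commutes with multiplying by a different one. -/
theorem mul_X_divMonomial_single {σ R : Type*} [CommSemiring R] {i j : σ} (hij : i ≠ j)
    (f : MvPolynomial σ R) :
    (f * X i).divMonomial (Finsupp.single j 1) = f.divMonomial (Finsupp.single j 1) * X i := by
  classical
  ext m
  have hmem : i ∈ (Finsupp.single j 1 + m).support ↔ i ∈ m.support := by
    simp [hij.symm]
  rw [coeff_divMonomial, coeff_mul_X', coeff_mul_X', coeff_divMonomial]
  simp only [hmem]
  split_ifs with h
  · congr 1
    ext l
    by_cases hl : i = l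
    · subst hl
      simp [hij.symm]
    · simp [Finsupp.single_apply, hl]
  · rfl

/-- Powers of an ideal generated by variables are stable under division by any other variable. -/
theorem divMonomial_mem_span_X_pow {σ R : Type*} [CommSemiring R] {S : Set σ} {j : σ}
    (hj : j ∉ S) (m : ℕ) {f : MvPolynomial σ R} (hf : f ∈ Ideal.span (X '' S) ^ m) :
    f.divMonomial (Finsupp.single j 1) ∈
      Ideal.span (X '' S : Set (MvPolynomial σ R)) ^ m := by
  induction m generalizing f with
  | zero => simp
  | succ m ih =>
    rw [pow_succ] at hf
    induction hf using Submodule.mul_induction_on' with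
    | mem_mul_mem p hp q hq =>
      induction hq using Submodule.span_induction generalizing p with
      | mem x hx =>
        obtain ⟨i, hi, rfl⟩ := hx
        rw [mul_X_divMonomial_single (ne_of_mem_of_not_mem hi hj), pow_succ]
        exact Ideal.mul_mem_mul (ih hp) (Ideal.subset_span ⟨i, hi, rfl⟩)
      | zero => simp
      | add x y _ _ hx hy =>
        rw [mul_add, add_divMonomial]
        exact add_mem (hx p hp) (hy p hp)
      | smul r x _ hx =>
        rw [smul_eq_mul, mul_left_comm, ← mul_assoc]
        exact hx _ (Ideal.mul_mem_left _ r hp)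
    | add p _ q _ hp hq =>
      rw [add_divMonomial]
      exact add_mem hp hq

/-- A variable outside `S` is a nonzerodivisor modulo each power of the ideal generated
by the variables in `S`. -/
theorem mem_span_X_pow_of_X_mul_mem {σ R : Type*} [CommSemiring R] {S : Set σ} {j : σ}
    (hj : j ∉ S) (m : ℕ) {f : MvPolynomial σ R} (hf : X j * f ∈ Ideal.span (X '' S) ^ m) :
    f ∈ Ideal.span (X '' S : Set (MvPolynomial σ R)) ^ m := by
  simpa [X_mul_divMonomial] using divMonomial_mem_span_X_pow hj m hf

/-- A power of the ideal of variables indexed by `S` lies in any smaller power of `Pt k n t`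
when `t ∉ S`. -/
theorem span_X_pow_le_Pt_pow (k : Type*) [Field k] {n : ℕ} {S : Set (Fin n)} {t : Fin n}
    (ht : t ∉ S) {l m : ℕ} (hlm : l ≤ m) :
    Ideal.span (X '' S : Set (MvPolynomial (Fin n) k)) ^ m ≤ Pt k n t ^ l :=
  have hle : Ideal.span (X '' S : Set (MvPolynomial (Fin n) k)) ≤ Pt k n t :=
    Ideal.span_mono (Set.image_mono fun _ hi => ne_of_mem_of_not_mem hi ht)
  (Ideal.pow_le_pow_right hlm).trans (Ideal.pow_right_mono hle l)

/-- For `1 ≤ a ≤ b ≤ c`, with `J = x₁ · I_{n,a,b-1,c-1}` and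
`K = (x₃,…,xₙ)^b ∩ (x₂,x₄,…,xₙ)^c`, one has `J ∩ K = x₁ · K`. -/
theorem J_inter_K (k : Type*) [Field k] (n : ℕ) (hn : 4 ≤ n)
    (a b c : ℕ) (ha : 1 ≤ a) (hab : a ≤ b) (hbc : b ≤ c) :
    (Ideal.span {(X (⟨0, by omega⟩ : Fin n) : MvPolynomial (Fin n) k)}
        * fatIdeal k n hn a (b - 1) (c - 1)) ⊓ Kideal k n hn b c
      = Ideal.span {(X (⟨0, by omega⟩ : Fin n) : MvPolynomial (Fin n) k)}
        * Kideal k n hn b c := by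
  apply le_antisymm
  · rintro _ ⟨hJ, hK⟩
    obtain ⟨f, -, rfl⟩ := Ideal.mem_span_singleton_mul.1 hJ
    exact Ideal.mem_span_singleton_mul.2 ⟨f,
      ⟨mem_span_X_pow_of_X_mul_mem (by simp) b hK.1,
        mem_span_X_pow_of_X_mul_mem (by simp) c hK.2⟩, rfl⟩
  · refine le_inf (Ideal.mul_mono_right (le_inf (le_inf ?_ ?_) ?_)) Ideal.mul_le_right
    · exact inf_le_left.trans (span_X_pow_le_Pt_pow k (by simp) hab)
    · exact inf_le_left.trans (span_X_pow_le_Pt_pow k (by simp) (Nat.sub_le b 1))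
    · exact inf_le_right.trans (span_X_pow_le_Pt_pow k (by simp) (Nat.sub_le c 1))
end
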